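/- Let f ∈ ℍ[t] be a nonzero polynomial over the quaternions and let α ∈ ℍ. Then the similarity class [α] contains a right root of f if and only if [α] contains a right root of the companion polynomial f̄·f. -/

import Mathlib

open Polynomial

/-- Right evaluation of a quaternionic polynomial `f` at `β`:
`evʳ_f(β) = Σ_k f_k β^k`, coefficients on the left. -/
noncomputable def evalR (β : Quaternion ℝ) (f : Polynomial (Quaternion ℝ)) : Quaternion ℝ :=
  ∑ k ∈ Finset.range (f.natDegree + 1), f.coeff k * β ^ k

/-- The similarity class of a quaternion `α`: all `γ α γ⁻¹` with `γ ≠ 0`. -/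
def simClass (α : Quaternion ℝ) : Set (Quaternion ℝ) :=
  {β | ∃ γ : Quaternion ℝ, γ ≠ 0 ∧ β = γ * α * γ⁻¹}

/-- The conjugate polynomial `f̄`, obtained by applying quaternionic conjugation
to each coefficient of `f`. -/
noncomputable def pconj (f : Polynomial (Quaternion ℝ)) : Polynomial (Quaternion ℝ) :=
  ∑ k ∈ Finset.range (f.natDegree + 1), Polynomial.C (star (f.coeff k)) * Polynomial.X ^ k

lemma evalR_eq (β : Quaternion ℝ) (f : Polynomial (Quaternion ℝ)) : evalR β f = f.eval β := by
  rw [evalR, Polynomial.eval_eq_sum_range]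

lemma eval_mul_aux (p q : Polynomial (Quaternion ℝ)) (β δ : Quaternion ℝ)
    (h : SemiconjBy (q.eval β) β δ) : (p * q).eval β = p.eval δ * q.eval β := by
  induction p using Polynomial.induction_on' with
  | add p r hp hr => rw [add_mul, eval_add, hp, hr, eval_add, add_mul]
  | monomial k a =>
    rw [← C_mul_X_pow_eq_monomial, mul_assoc, X_pow_mul, eval_C_mul, eval_mul_X_pow, eval_C_mul,
      mul_assoc, (h.pow_right k).eq, ← one_mul (X ^ k : Polynomial (Quaternion ℝ)), eval_mul_X_pow]
    simp

lemma pow_lin (t n : ℝ) (k : ℕ) : ∃ a b : ℝ, ∀ β : Quaternion ℝ,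
    β * β = (t : Quaternion ℝ) * β - (n : Quaternion ℝ) →
      β ^ k = (a : Quaternion ℝ) + (b : Quaternion ℝ) * β := by
  induction k with
  | zero => exact ⟨1, 0, fun β _ => by simp⟩
  | succ k ih =>
    obtain ⟨a, b, h⟩ := ih
    refine ⟨-(b * n), a + b * t, fun β hβ => ?_⟩
    rw [pow_succ, h β hβ, add_mul, mul_assoc, hβ]
    push_cast
    noncomm_ring

lemma eval_lin (t n : ℝ) (f : Polynomial (Quaternion ℝ)) : ∃ A B : Quaternion ℝ,
    ∀ β : Quaternion ℝ, β * β = (t : Quaternion ℝ) * β - (n : Quaternion ℝ) →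
      f.eval β = A + B * β ∧ (pconj f).eval β = star A + star B * β := by
  choose a b h using pow_lin t n
  refine ⟨∑ k ∈ Finset.range (f.natDegree + 1), f.coeff k * (a k : Quaternion ℝ),
    ∑ k ∈ Finset.range (f.natDegree + 1), f.coeff k * (b k : Quaternion ℝ), fun β hβ => ⟨?_, ?_⟩⟩
  · rw [eval_eq_sum_range, Finset.sum_mul, ← Finset.sum_add_distrib]
    refine Finset.sum_congr rfl fun k _ => ?_
    rw [h k β hβ, mul_add, mul_assoc]
  · rw [pconj, eval_finsetSum, star_sum, star_sum, Finset.sum_mul, ← Finset.sum_add_distrib]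
    refine Finset.sum_congr rfl fun k _ => ?_
    rw [C_mul_X_pow_eq_monomial, eval_monomial, h k β hβ, mul_add, star_mul, star_mul,
      Quaternion.star_coe, Quaternion.star_coe, ← Quaternion.coe_commutes (a k),
      ← mul_assoc, ← Quaternion.coe_commutes (b k)]

lemma sim_quad (β : Quaternion ℝ) : β * β = ((2 * β.re : ℝ) : Quaternion ℝ) * β
    - ((Quaternion.normSq β : ℝ) : Quaternion ℝ) := by
  rw [← Quaternion.star_mul_self, ← sub_mul]
  congr 1
  ext <;> simp
  ring

lemma star_sim (δ : Quaternion ℝ) : ∃ γ : Quaternion ℝ, γ ≠ 0 ∧ star δ = γ * δ * γ⁻¹ := by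
  suffices ∃ γ : Quaternion ℝ, γ ≠ 0 ∧ star δ * γ = γ * δ by
    obtain ⟨γ, h0, h⟩ := this
    exact ⟨γ, h0, by rw [← h, mul_assoc, mul_inv_cancel₀ h0, mul_one]⟩
  have mk : ∀ x y : ℝ, ∃ γ : Quaternion ℝ, γ.re = 0 ∧ γ.imI = x ∧ γ.imJ = y ∧ γ.imK = 0 :=
    fun x y => ⟨⟨0, x, y, 0⟩, rfl, rfl, rfl, rfl⟩
  by_cases h : δ.imI = 0 ∧ δ.imJ = 0
  · obtain ⟨γ, h1, h2, h3, h4⟩ := mk 1 0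
    refine ⟨γ, fun h0 => ?_, ?_⟩
    · rw [h0] at h2
      exact zero_ne_one (α := ℝ) h2
    · apply Quaternion.ext <;> simp [h.1, h.2, h1, h2, h3, h4]
  · obtain ⟨γ, h1, h2, h3, h4⟩ := mk δ.imJ (-δ.imI)
    refine ⟨γ, fun h0 => h ⟨?_, ?_⟩, ?_⟩
    · rw [h0] at h3
      exact neg_eq_zero.1 h3.symm
    · rw [h0] at h2
      exact h2.symm
    · apply Quaternion.ext <;> simp [h1, h2, h3, h4] <;> ring

lemma sim_trans {α β γ : Quaternion ℝ} (h : β ∈ simClass α) (h0 : γ ≠ 0) :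
    γ * β * γ⁻¹ ∈ simClass α := by
  obtain ⟨c, hc, rfl⟩ := h
  exact ⟨γ * c, mul_ne_zero h0 hc, by simp only [mul_inv_rev, mul_assoc]⟩

/-- A similarity class `[α]` contains a right root of a nonzero quaternionic polynomial
`f` if and only if it contains a right root of the companion polynomial `f̄ f`. -/
theorem root_in_class_iff_companion (f : Polynomial (Quaternion ℝ)) (hf : f ≠ 0)
    (α : Quaternion ℝ) :
    (∃ β ∈ simClass α, evalR β f = 0) ↔ (∃ β ∈ simClass α, evalR β (pconj f * f) = 0) := by
  simp only [evalR_eq]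
  constructor
  · rintro ⟨β, hβ, h⟩
    refine ⟨β, hβ, ?_⟩
    rw [eval_mul_aux _ _ β β (by rw [h]; simp), h, mul_zero]
  · rintro ⟨β, hβ, h⟩
    by_cases hc : f.eval β = 0
    · exact ⟨β, hβ, hc⟩
    obtain ⟨δ, hδ, hr⟩ : ∃ δ ∈ simClass α, (pconj f).eval δ = 0 := by
      refine ⟨_, sim_trans hβ hc, ?_⟩
      rw [eval_mul_aux _ _ β (f.eval β * β * (f.eval β)⁻¹)
        (by rw [SemiconjBy, mul_assoc _ _ (f.eval β), inv_mul_cancel₀ hc, mul_one])] at h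
      exact (mul_eq_zero.1 h).resolve_right hc
    obtain ⟨A, B, hAB⟩ := eval_lin (2 * δ.re) (Quaternion.normSq δ) f
    have h1 := (hAB δ (sim_quad δ)).2
    rw [hr] at h1
    have h2 : A + star δ * B = 0 := by
      have := congrArg star h1
      simpa using this.symm
    by_cases hB : B = 0
    · refine ⟨δ, hδ, ?_⟩
      rw [(hAB δ (sim_quad δ)).1]
      simpa [hB] using h2
    · obtain ⟨γ, h0, hγ⟩ := star_sim δ
      have hs : star δ ∈ simClass α := hγ ▸ sim_trans hδ h0
      have he := sim_trans hs (inv_ne_zero hB)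
      rw [inv_inv] at he
      refine ⟨_, he, ?_⟩
      have hq : star δ * star δ = ((2 * δ.re : ℝ) : Quaternion ℝ) * star δ
          - ((Quaternion.normSq δ : ℝ) : Quaternion ℝ) := by
        simpa [Quaternion.normSq_star] using sim_quad (star δ)
      rw [(hAB _ ?_).1]
      · rw [mul_assoc B⁻¹, mul_inv_cancel_left₀ hB, h2]
      · calc B⁻¹ * star δ * B * (B⁻¹ * star δ * B) = B⁻¹ * (star δ * star δ) * B := by
              simp only [mul_assoc, mul_inv_cancel_left₀ hB]
          _ = _ := by
              rw [hq, mul_sub, sub_mul, ← mul_assoc, ← Quaternion.coe_commutes,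
                ← Quaternion.coe_commutes (Quaternion.normSq δ), mul_assoc _ B⁻¹ B,
                inv_mul_cancel₀ hB, mul_one]
              simp only [mul_assoc]
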